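/- arXiv:1805.11060 — 3 statements merged into one kernel-verified Lean document; each statement's English description precedes it below -/
import Mathlib

section
/- For every real number p with 0 < p < 1 and every integer w ≥ 1, the series ∑_{t=w}^∞ p·(1-p)^{t-1} · binom(t-1, w-1) · (1/2)^{t-1} converges and its sum equals (2p/(1-p)) · ((1-p)/(1+p))^w. -/
/-- For every real `p` with `0 < p < 1` and every integer `w ≥ 1`, the series
`∑_{t=w}^∞ p·(1-p)^{t-1} · binom(t-1, w-1) · (1/2)^{t-1}` converges with sum
`(2p/(1-p)) · ((1-p)/(1+p))^w`.  The sum over `t ≥ w` is indexed by `t = n + w`, `n : ℕ`. -/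
theorem wardsize_sum (p : ℝ) (hp0 : 0 < p) (hp1 : p < 1) (w : ℕ) (hw : 1 ≤ w) :
    HasSum
      (fun n : ℕ =>
        p * (1 - p) ^ (n + w - 1) * (Nat.choose (n + w - 1) (w - 1) : ℝ) *
          (1 / 2 : ℝ) ^ (n + w - 1))
      (2 * p / (1 - p) * ((1 - p) / (1 + p)) ^ w) := by
  obtain ⟨k, rfl⟩ := Nat.exists_eq_add_of_le' hw
  have hr : ‖(1 - p) / 2‖ < 1 := by
    rw [Real.norm_eq_abs, abs_lt]
    constructor <;> linarith
  convert! (hasSum_choose_mul_geometric_of_norm_lt_one k hr).mul_left (p * ((1 - p) / 2) ^ k)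
    using 1
  · ext n
    simp only [← add_assoc, Nat.add_sub_cancel, div_pow, one_pow, pow_add]
    field_simp
  · have h₁ : 1 - p ≠ 0 := by linarith
    have h₂ : 1 + p ≠ 0 := by linarith
    have h₃ : 1 - (1 - p) / 2 = (1 + p) / 2 := by ring
    rw [h₃]
    simp only [div_pow, pow_succ]
    field_simp
end

section
/- For every real number p with 0 ≤ p ≤ 1, the series ∑_{w=1}^∞ C_w · ((1-p)/2)^{w-1} · ((1+p)/2)^{w+1} converges and its sum equals 1, where C_w = (2w)!/((w+1)!·w!) denotes the w-th Catalan number. -/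
open Finset in
/-- The partial sums of a convolution of a nonnegative sequence with itself are bounded by the
square of its partial sums. -/
lemma sum_range_sum_antidiagonal_le_sq {f : ℕ → ℝ} (hf : ∀ n, 0 ≤ f n) (N : ℕ) :
    ∑ n ∈ range N, ∑ ij ∈ Finset.HasAntidiagonal.antidiagonal n, f ij.1 * f ij.2 ≤
      (∑ n ∈ range N, f n) ^ 2 := by
  have hfiber : ∀ n ∈ range N, Finset.HasAntidiagonal.antidiagonal n =
      {ij ∈ range N ×ˢ range N | ij.1 + ij.2 = n} := by
    intro n hn
    ext ⟨i, j⟩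
    simp only [Finset.HasAntidiagonal.mem_antidiagonal, mem_filter, mem_product, mem_range] at hn ⊢
    omega
  rw [sum_congr rfl fun n hn => by rw [hfiber n hn], sq, sum_mul_sum, ← sum_product']
  exact sum_fiberwise_le_sum_of_sum_fiber_nonneg fun _ _ =>
    sum_nonneg fun _ _ => mul_nonneg (hf _) (hf _)

/-- The Catalan recursion, weighted by powers of `x`. -/
lemma catalan_succ_mul_pow (x : ℝ) (n : ℕ) :
    (catalan (n + 1) : ℝ) * x ^ n =
      ∑ ij ∈ Finset.HasAntidiagonal.antidiagonal n,
        catalan ij.1 * x ^ ij.1 * (catalan ij.2 * x ^ ij.2) := by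
  rw [catalan_succ']
  push_cast
  rw [Finset.sum_mul]
  refine Finset.sum_congr rfl fun ij hij => ?_
  rw [← Finset.HasAntidiagonal.mem_antidiagonal.mp hij, pow_add]
  ring

/-- If `G` is a supersolution of `G = 1 + x * G ^ 2`, it bounds the partial sums of the Catalan
generating function at `x`. -/
lemma sum_range_catalan_mul_pow_le {x G : ℝ} (hx : 0 ≤ x) (hG : 0 ≤ G)
    (h : 1 + x * G ^ 2 ≤ G) (N : ℕ) :
    ∑ n ∈ Finset.range N, (catalan n : ℝ) * x ^ n ≤ G := by
  induction N with
  | zero => simpa using hG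
  | succ N ih =>
    have hnonneg : ∀ n, 0 ≤ (catalan n : ℝ) * x ^ n := fun n => by positivity
    have hconv := sum_range_sum_antidiagonal_le_sq hnonneg N
    simp_rw [← catalan_succ_mul_pow] at hconv
    have hsq := pow_le_pow_left₀ (Finset.sum_nonneg fun n _ => hnonneg n) ih 2
    calc ∑ n ∈ Finset.range (N + 1), (catalan n : ℝ) * x ^ n
        = 1 + x * ∑ n ∈ Finset.range N, (catalan (n + 1) : ℝ) * x ^ n := by
          rw [Finset.sum_range_succ', Finset.mul_sum, add_comm]
          simp only [catalan_zero, Nat.cast_one, pow_zero, mul_one, pow_succ]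
          congr 1
          exact Finset.sum_congr rfl fun n _ => by ring
      _ ≤ 1 + x * G ^ 2 := by gcongr; exact hconv.trans hsq
      _ ≤ G := h

/-- The Catalan generating function shifted by one is the square of the generating function. -/
lemma hasSum_catalan_succ_mul_pow {x G : ℝ}
    (h : HasSum (fun n : ℕ => (catalan n : ℝ) * x ^ n) G) :
    HasSum (fun n : ℕ => (catalan (n + 1) : ℝ) * x ^ n) (G ^ 2) := by
  have hnorm : Summable fun n : ℕ => ‖(catalan n : ℝ) * x ^ n‖ := h.summable.norm
  have hsum := (summable_norm_sum_mul_antidiagonal_of_summable_norm hnorm hnorm).of_norm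
  have htsum := tsum_mul_tsum_eq_tsum_sum_antidiagonal_of_summable_norm hnorm hnorm
  simp_rw [← catalan_succ_mul_pow] at hsum htsum
  rw [h.tsum_eq, ← sq] at htsum
  exact htsum ▸ hsum.hasSum

/-- The Catalan generating function at `a * b`, where `a + b = 1` and `0 ≤ a ≤ b`. -/
lemma hasSum_catalan_mul_pow {a b : ℝ} (ha : 0 ≤ a) (hab : a ≤ b) (h : a + b = 1) :
    HasSum (fun n : ℕ => (catalan n : ℝ) * (a * b) ^ n) b⁻¹ := by
  have hb : 0 < b := by linarith
  have hx : 0 ≤ a * b := mul_nonneg ha hb.le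
  have hbound := sum_range_catalan_mul_pow_le hx (inv_nonneg.mpr hb.le) (by
    apply le_of_eq
    field_simp
    linarith)
  have hsummable := summable_of_sum_range_le (fun n => by positivity) hbound
  obtain ⟨G, hG⟩ := hsummable
  have hle : G ≤ b⁻¹ := le_of_tendsto' hG.tendsto_sum_nat hbound
  have heq : G = 1 + a * b * G ^ 2 := by
    have hshift := (hasSum_catalan_succ_mul_pow hG).mul_left (a * b)
    have htail := (hasSum_nat_add_iff' 1).mpr hG
    have := htail.unique (hshift.congr_fun fun n => by ring)
    simp only [Finset.sum_range_one, catalan_zero, Nat.cast_one, pow_zero, mul_one] at this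
    linarith
  have hbG : b * G ≤ 1 := by
    calc b * G ≤ b * b⁻¹ := by gcongr
      _ = 1 := mul_inv_cancel₀ hb.ne'
  have hG0 : 0 ≤ G := hG.nonneg fun n => by positivity
  have hroots : (b * G - 1) * (a * G - 1) = 0 := by
    linear_combination -heq - G * h
  have hone : b * G = 1 := by
    rcases mul_eq_zero.mp hroots with h0 | h0
    · linarith
    · have := mul_le_mul_of_nonneg_right hab hG0
      linarith
  rwa [← eq_inv_of_mul_eq_one_right hone]

/-- The factorial formula for the Catalan numbers, over a field of characteristic zero. -/
lemma catalan_cast_eq_factorial_div {K : Type*} [Field K] [CharZero K] (n : ℕ) :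
    (catalan n : K) = (2 * n).factorial / ((n + 1).factorial * n.factorial) := by
  have hcentral : ((n : K) + 1) * catalan n = n.centralBinom :=
    mod_cast succ_mul_catalan_eq_centralBinom n
  have hfact : (n.centralBinom : K) * n.factorial * n.factorial = (2 * n).factorial := by
    have := Nat.choose_mul_factorial_mul_factorial (show n ≤ 2 * n by omega)
    rw [show 2 * n - n = n by omega] at this
    exact mod_cast this
  rw [eq_div_iff (by simp [Nat.factorial_ne_zero]), ← hfact, ← hcentral, Nat.factorial_succ]
  push_cast
  ring

/-- For `0 ≤ p ≤ 1`, the series `∑_{w=1}^∞ C_w · ((1-p)/2)^{w-1} · ((1+p)/2)^{w+1}` converges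
with sum `1`, where `C_w = (2w)!/((w+1)!·w!)` is the `w`-th Catalan number.
The sum over `w ≥ 1` is indexed by `w = n + 1`. -/
theorem all_to_one_distribution_normalized (p : ℝ) (hp0 : 0 ≤ p) (hp1 : p ≤ 1) :
    HasSum
      (fun n : ℕ =>
        ((Nat.factorial (2 * (n + 1)) : ℝ) /
            ((Nat.factorial (n + 2) : ℝ) * (Nat.factorial (n + 1) : ℝ))) *
          ((1 - p) / 2) ^ n * ((1 + p) / 2) ^ (n + 2))
      1 := by
  have hb : (1 + p) / 2 ≠ 0 := by positivity
  have hG := hasSum_catalan_mul_pow (a := (1 - p) / 2) (b := (1 + p) / 2)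
    (by linarith) (by linarith) (by ring)
  have hsum := (hasSum_catalan_succ_mul_pow hG).mul_right (((1 + p) / 2) ^ 2)
  rw [← mul_pow, inv_mul_cancel₀ hb, one_pow] at hsum
  refine hsum.congr_fun fun n => ?_
  rw [catalan_cast_eq_factorial_div, mul_pow, pow_add]
  ring
end

section
/- For every real number p with 0 ≤ p ≤ 1, the series S(p) = ∑_{w=1}^∞ (1/w) · C_w · ((1-p)/2)^{w-1} · ((1+p)/2)^{w+1} converges and satisfies (1+p)²/4 ≤ S(p) ≤ (e²/(2π)) · (1+p)², where C_w = (2w)!/((w+1)!·w!) denotes the w-th Catalan number. -/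
/-- The telescoping series `∑ 1 / ((n + 1) (n + 2))` sums to `1`. -/
theorem hasSum_one_div_succ_mul_succ_succ :
    HasSum (fun n : ℕ => 1 / ((n + 1 : ℝ) * (n + 2))) 1 := by
  rw [hasSum_iff_tendsto_nat_of_nonneg (fun n => by positivity)]
  have hsum (n : ℕ) :
      ∑ i ∈ Finset.range n, 1 / ((i + 1 : ℝ) * (i + 2)) = 1 - 1 / ((n : ℝ) + 1) := by
    induction n with
    | zero => simp
    | succ k ih =>
      rw [Finset.sum_range_succ, ih]
      push_cast
      field_simp
      ring
  simp only [hsum]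
  simpa using tendsto_one_div_add_atTop_nhds_zero_nat (𝕜 := ℝ).const_sub 1

/-- The Catalan number `(2w)! / ((w + 1)! w!)` is at most `4 ^ w / (w + 1)`. -/
theorem factorial_two_mul_div_le_four_pow_div (w : ℕ) :
    ((2 * w).factorial : ℝ) / ((w + 1).factorial * w.factorial) ≤ 4 ^ w / (w + 1) := by
  have hfac : ((2 * w).factorial : ℝ) = w.centralBinom * w.factorial * w.factorial := by
    rw [two_mul, ← Nat.add_choose_mul_factorial_mul_factorial, ← two_mul,
      ← Nat.centralBinom_eq_two_mul_choose]
    push_cast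
    rfl
  have hbinom : (w.centralBinom : ℝ) ≤ 4 ^ w := mod_cast Nat.centralBinom_le_four_pow w
  have hpos : (0 : ℝ) < w.factorial := mod_cast w.factorial_pos
  have hcat : ((2 * w).factorial : ℝ) / ((w + 1).factorial * w.factorial) =
      w.centralBinom / (w + 1) := by
    rw [hfac, Nat.factorial_succ]
    push_cast
    field_simp
  rw [hcat]
  gcongr

theorem one_le_exp_one_sq_div_two_pi : 1 ≤ Real.exp 1 ^ 2 / (2 * Real.pi) := by
  rw [one_le_div (by positivity)]
  nlinarith [Real.exp_one_gt_d9, Real.pi_lt_d2]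


/-- For `0 ≤ p ≤ 1`, the series `S(p) = ∑_{w=1}^∞ (1/w)·C_w·((1-p)/2)^{w-1}·((1+p)/2)^{w+1}`
converges and `(1+p)²/4 ≤ S(p) ≤ (e²/(2π))·(1+p)²`, where `C_w = (2w)!/((w+1)!·w!)` is the
`w`-th Catalan number.  The sum over `w ≥ 1` is indexed by `w = n + 1`. -/
theorem all_to_one_expected_inverse_ward_bounds (p : ℝ) (hp0 : 0 ≤ p) (hp1 : p ≤ 1) :
    ∃ S : ℝ,
      HasSum
        (fun n : ℕ =>
          (1 / (n + 1 : ℝ)) *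
            ((Nat.factorial (2 * (n + 1)) : ℝ) /
              ((Nat.factorial (n + 2) : ℝ) * (Nat.factorial (n + 1) : ℝ))) *
            ((1 - p) / 2) ^ n * ((1 + p) / 2) ^ (n + 2))
        S ∧
      (1 + p) ^ 2 / 4 ≤ S ∧ S ≤ Real.exp 1 ^ 2 / (2 * Real.pi) * (1 + p) ^ 2 := by
  set f : ℕ → ℝ := fun n =>
    (1 / (n + 1 : ℝ)) *
      ((Nat.factorial (2 * (n + 1)) : ℝ) /
        ((Nat.factorial (n + 2) : ℝ) * (Nat.factorial (n + 1) : ℝ))) *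
      ((1 - p) / 2) ^ n * ((1 + p) / 2) ^ (n + 2) with hf
  have hx : 0 ≤ (1 - p) / 2 := by linarith
  have hy : 0 ≤ (1 + p) / 2 := by linarith
  have hf_nonneg (n : ℕ) : 0 ≤ f n := by positivity
  have hf_le (n : ℕ) : f n ≤ (1 + p) ^ 2 * (1 / ((n + 1 : ℝ) * (n + 2))) := by
    have hpow : (1 - p ^ 2) ^ n ≤ 1 := pow_le_one₀ (by nlinarith) (by nlinarith)
    have hcat := factorial_two_mul_div_le_four_pow_div (n + 1)
    have hprod : (4 : ℝ) ^ n * (((1 - p) / 2) ^ n * ((1 + p) / 2) ^ n) = (1 - p ^ 2) ^ n := by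
      rw [← mul_pow, ← mul_pow]
      ring
    calc f n ≤ (1 / (n + 1 : ℝ)) * (4 ^ (n + 1) / ((n + 1 : ℕ) + 1)) *
          ((1 - p) / 2) ^ n * ((1 + p) / 2) ^ (n + 2) := by
          simp only [hf]
          gcongr
      _ = (1 + p) ^ 2 * (1 / ((n + 1 : ℝ) * (n + 2))) * (1 - p ^ 2) ^ n := by
          rw [← hprod]
          push_cast
          rw [pow_succ (4 : ℝ), pow_add ((1 + p) / 2), add_assoc (n : ℝ) 1 1, one_add_one_eq_two]
          field_simp
          ring
      _ ≤ (1 + p) ^ 2 * (1 / ((n + 1 : ℝ) * (n + 2))) :=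
          mul_le_of_le_one_right (by positivity) hpow
  have hbound := hasSum_one_div_succ_mul_succ_succ.mul_left ((1 + p) ^ 2)
  have hsum : Summable f := hbound.summable.of_nonneg_of_le hf_nonneg hf_le
  refine ⟨∑' n, f n, hsum.hasSum, ?_, ?_⟩
  · have hf_zero : f 0 = (1 + p) ^ 2 / 4 := by
      norm_num [hf, Nat.factorial]
      ring
    exact hf_zero ▸ hsum.le_tsum 0 fun n _ => hf_nonneg n
  · calc ∑' n, f n ≤ (1 + p) ^ 2 * 1 := hasSum_le hf_le hsum.hasSum hbound
      _ = 1 * (1 + p) ^ 2 := by ring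
      _ ≤ Real.exp 1 ^ 2 / (2 * Real.pi) * (1 + p) ^ 2 := by
          gcongr
          exact one_le_exp_one_sq_div_two_pi
end
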